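/- Let G=(V,E) be a d-manifold with d odd. Then for every vertex x, the curvature satisfies K(x) = −E[χ(M_f(x))]/2, where the expectation is over uniformly random bijections f:V→{1,...,|V|}. -/

import Mathlib

open scoped Classical

/-- A finite simple graph: a finite vertex set together with a symmetric, irreflexive
adjacency relation supported on the vertex set. -/
structure FGraph (V : Type) where
  verts : Finset V
  Adj : V → V → Prop
  symm : ∀ {a b}, Adj a b → Adj b a
  loopless : ∀ a, ¬ Adj a a
  mem_of_adj : ∀ {a b}, Adj a b → a ∈ verts

namespace FGraph

variable {V W : Type}

/-- The subgraph induced on the vertices satisfying `P`. -/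
noncomputable def induce (G : FGraph V) (P : V → Prop) : FGraph V where
  verts := G.verts.filter P
  Adj a b := G.Adj a b ∧ P a ∧ P b
  symm h := ⟨G.symm h.1, h.2.2, h.2.1⟩
  loopless a h := G.loopless a h.1
  mem_of_adj h := Finset.mem_filter.mpr ⟨G.mem_of_adj h.1, h.2.1⟩

/-- The unit sphere of a vertex: the subgraph induced on its neighbors. -/
noncomputable def unitSphere (G : FGraph V) (v : V) : FGraph V :=
  G.induce (fun w => G.Adj v w)

/-- The graph with the vertex `v` (and its edges) removed. -/
noncomputable def erase (G : FGraph V) (v : V) : FGraph V :=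
  G.induce (fun w => w ≠ v)

/-- Inductive definition of contractibility: the one-point graph is contractible, and a
graph is contractible if some vertex has a contractible unit sphere and contractible
complement. -/
inductive Contractible : FGraph V → Prop
  | single (G : FGraph V) (v : V) (h : G.verts = {v}) : Contractible G
  | step (G : FGraph V) (v : V) (hv : v ∈ G.verts)
      (h1 : Contractible (G.unitSphere v)) (h2 : Contractible (G.erase v)) :
      Contractible G

mutual
  /-- `G` is a `d`-sphere: the empty graph is the `(-1)`-sphere, and a `d`-manifold is a
  `d`-sphere if removing some vertex renders it contractible. -/
  inductive IsSphere : ℤ → FGraph V → Prop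
    | empty (G : FGraph V) (h : G.verts = ∅) : IsSphere (-1) G
    | punctured (d : ℤ) (G : FGraph V) (hm : IsManifold d G) (v : V) (hv : v ∈ G.verts)
        (hc : Contractible (G.erase v)) : IsSphere d G
  /-- For `d ≥ 0`, `G` is a `d`-manifold iff every unit sphere is a `(d-1)`-sphere. -/
  inductive IsManifold : ℤ → FGraph V → Prop
    | intro (d : ℤ) (hd : 0 ≤ d) (G : FGraph V)
        (h : ∀ v ∈ G.verts, IsSphere (d - 1) (G.unitSphere v)) : IsManifold d G
end

/-- A simplex of `G`: the vertex set of a complete subgraph. -/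
def IsSimplex (G : FGraph V) (x : Finset V) : Prop :=
  x.Nonempty ∧ ↑x ⊆ G.verts ∧ ∀ a ∈ x, ∀ b ∈ x, a ≠ b → G.Adj a b

/-- The Barycentric refinement: vertices are the simplices of `G`, two being adjacent iff
one is strictly contained in the other. -/
noncomputable def barycentric (G : FGraph V) : FGraph (Finset V) where
  verts := G.verts.powerset.filter (fun x => G.IsSimplex x)
  Adj x y := G.IsSimplex x ∧ G.IsSimplex y ∧ (x ⊂ y ∨ y ⊂ x)
  symm h := ⟨h.2.1, h.1, h.2.2.symm⟩
  loopless x h := by rcases h.2.2 with h' | h' <;> exact (ssubset_irrefl x h')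
  mem_of_adj h := Finset.mem_filter.mpr ⟨Finset.mem_powerset.mpr h.1.2.1, h.1⟩

/-- Number of simplices of `G` with exactly `j` vertices (so `numSimplices G (k+1)` is
the `f`-vector entry `f_k(G)`). -/
noncomputable def numSimplices (G : FGraph V) (j : ℕ) : ℕ :=
  (G.verts.powerset.filter (fun x => G.IsSimplex x ∧ x.card = j)).card

/-- Euler characteristic `χ(G) = Σ_{k ≥ 0} (-1)^k f_k(G)`, where `f_k` counts the
simplices with `k+1` vertices. -/
noncomputable def euler (G : FGraph V) : ℤ :=
  ∑ k ∈ Finset.range G.verts.card, (-1 : ℤ) ^ k * G.numSimplices (k + 1)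

/-- The level set `{f = c}`: the subgraph of the Barycentric refinement induced by the
simplices on which `f - c` changes sign. -/
noncomputable def levelSet (G : FGraph V) (f : V → ℝ) (c : ℝ) : FGraph (Finset V) :=
  G.barycentric.induce (fun x => (∃ a ∈ x, f a - c < 0) ∧ (∃ b ∈ x, 0 < f b - c))

/-- Graph isomorphism. -/
def Iso (G : FGraph V) (H : FGraph W) : Prop :=
  ∃ φ : V → W, Set.BijOn φ ↑G.verts ↑H.verts ∧
    ∀ a ∈ G.verts, ∀ b ∈ G.verts, (G.Adj a b ↔ H.Adj (φ a) (φ b))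

/-- Zykov join of two graphs: disjoint union plus all edges between the two parts. -/
noncomputable def join (G : FGraph V) (H : FGraph W) : FGraph (V ⊕ W) where
  verts := G.verts.disjSum H.verts
  Adj a b :=
    match a, b with
    | .inl a, .inl b => G.Adj a b
    | .inr a, .inr b => H.Adj a b
    | .inl a, .inr b => a ∈ G.verts ∧ b ∈ H.verts
    | .inr a, .inl b => b ∈ G.verts ∧ a ∈ H.verts
  symm {a b} h := by
    cases a <;> cases b <;> simp_all <;> first | exact G.symm h | exact H.symm h
  loopless a h := by
    cases a <;> simp_all <;> first | exact G.loopless _ h | exact H.loopless _ h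
  mem_of_adj {a b} h := by
    cases a <;> cases b <;> simp_all [Finset.mem_disjSum] <;>
      first | exact G.mem_of_adj h | exact H.mem_of_adj h

/-- Union of two graphs on the same vertex type. -/
noncomputable def union (G H : FGraph V) : FGraph V where
  verts := G.verts ∪ H.verts
  Adj a b := G.Adj a b ∨ H.Adj a b
  symm h := h.imp G.symm H.symm
  loopless a h := h.elim (G.loopless a) (H.loopless a)
  mem_of_adj h :=
    h.elim (fun h' => Finset.mem_union_left _ (G.mem_of_adj h'))
      (fun h' => Finset.mem_union_right _ (H.mem_of_adj h'))

/-- A `d`-ball: a graph of the form `S - v` for a `d`-sphere `S` and a vertex `v` of `S`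
(up to graph isomorphism). -/
def IsBall (d : ℤ) (H : FGraph W) : Prop :=
  ∃ (S : FGraph ℕ) (v : ℕ), IsSphere d S ∧ v ∈ S.verts ∧ Iso H (S.erase v)

/-- A `d`-manifold with boundary: every unit sphere is a `(d-1)`-sphere or a `(d-1)`-ball. -/
def IsManifoldWithBoundary (d : ℤ) (G : FGraph V) : Prop :=
  ∀ v ∈ G.verts, IsSphere (d - 1) (G.unitSphere v) ∨ IsBall (d - 1) (G.unitSphere v)

/-- The cyclic graph `C_n` on the vertex set `Fin n`. -/
def cycleGraph (n : ℕ) : FGraph (Fin n) where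
  verts := Finset.univ
  Adj a b := a ≠ b ∧ ((a.val + 1) % n = b.val ∨ (b.val + 1) % n = a.val)
  symm h := ⟨h.1.symm, h.2.symm⟩
  loopless a h := h.1 rfl
  mem_of_adj _ := Finset.mem_univ _

/-- `G` is a disjoint union of cyclic graphs `C_n` with `n ≥ 4`: the vertex set splits
into pairwise disjoint pieces, edges never cross between pieces, and each piece induces
a graph isomorphic to a `C_n` with `n ≥ 4`. -/
def IsDisjointUnionOfCycles (G : FGraph V) : Prop :=
  ∃ P : Finset (Finset V),
    (∀ S ∈ P, ↑S ⊆ G.verts) ∧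
    (∀ S ∈ P, ∀ T ∈ P, S ≠ T → Disjoint S T) ∧
    (∀ v ∈ G.verts, ∃ S ∈ P, v ∈ S) ∧
    (∀ a b, G.Adj a b → ∀ S ∈ P, a ∈ S → b ∈ S) ∧
    (∀ S ∈ P, ∃ n, 4 ≤ n ∧ Iso (G.induce (· ∈ S)) (cycleGraph n))

/-- Poincaré–Hopf index `i_f(v) = 1 - χ(S^-_f(v))`. -/
noncomputable def pindex (G : FGraph V) (f : V → ℝ) (v : V) : ℤ :=
  1 - ((G.unitSphere v).induce (fun w => f w < f v)).euler

/-- Curvature `K(v) = Σ_{k ≥ 0} (-1)^k f_{k-1}(S(v))/(k+1)` with `f_{-1} = 1`. -/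
noncomputable def curvature (G : FGraph V) (v : V) : ℝ :=
  ∑ k ∈ Finset.range (G.verts.card + 1),
    (-1 : ℝ) ^ k * (if k = 0 then 1 else ((G.unitSphere v).numSimplices k : ℝ)) / (k + 1)

end FGraph

/-- `sign(a + i b) = sign(a) + i sign(b)`. -/
noncomputable def csgn (z : ℂ) : ℂ :=
  ⟨Real.sign z.re, Real.sign z.im⟩

/-- The set `U = {1+i, 1-i, -1+i, -1-i}` of possible values of `csgn`. -/
noncomputable def signU : Finset ℂ :=
  {1 + Complex.I, 1 - Complex.I, -1 + Complex.I, -1 - Complex.I}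

namespace FGraph

variable {V : Type}

/-- The set of values of `sign(ψ - c)` attained on the finite vertex set `x`. -/
noncomputable def signValues (ψ : V → ℂ) (c : ℂ) (x : Finset V) : Finset ℂ :=
  x.image (fun v => csgn (ψ v - c))

/-- The level set `{ψ = c}` of a complex-valued function: the subgraph of the Barycentric
refinement induced by the simplices on which `sign(ψ - c)` takes at least three distinct
values, including `-1+i` and `1-i`. -/
noncomputable def complexLevelSet (G : FGraph V) (ψ : V → ℂ) (c : ℂ) : FGraph (Finset V) :=
  G.barycentric.induce (fun x =>
    3 ≤ (signValues ψ c x).card ∧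
    (-1 + Complex.I) ∈ signValues ψ c x ∧ (1 - Complex.I) ∈ signValues ψ c x)

/-- The level set `{ψ = 0}_e` for a two-element subset `e ⊆ U`: the subgraph of the
Barycentric refinement induced by the simplices on which `sign(ψ)` attains both values
of `e` and at least three distinct values in total. -/
noncomputable def complexLevelSetE (G : FGraph V) (ψ : V → ℂ) (e : Finset ℂ) :
    FGraph (Finset V) :=
  G.barycentric.induce (fun x =>
    (∀ u ∈ e, u ∈ signValues ψ 0 x) ∧ 3 ≤ (signValues ψ 0 x).card)

/-- `Ψ^{-1}(t)`: the subgraph of the Barycentric refinement induced by the simplices on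
which `sign(ψ)` attains all values of `t`. -/
noncomputable def signPreimage (G : FGraph V) (ψ : V → ℂ) (t : Finset ℂ) :
    FGraph (Finset V) :=
  G.barycentric.induce (fun x => ∀ u ∈ t, u ∈ signValues ψ 0 x)

/-- The sign vectors of `F - c` attained on the finite vertex set `x`. -/
noncomputable def vecSignValues {k : ℕ} (F : V → Fin k → ℝ) (c : Fin k → ℝ)
    (x : Finset V) : Finset (Fin k → ℝ) :=
  x.image (fun v j => Real.sign (F v j - c j))

/-- The level set `{F = c}` of an `ℝ^k`-valued function: the subgraph of the Barycentric
refinement induced by the simplices on which the sign vector of `F - c` takes at least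
`k+1` distinct values, including the `k` vectors `(1,…,1,-1,1,…,1)`. -/
noncomputable def vecLevelSet (G : FGraph V) {k : ℕ} (F : V → Fin k → ℝ) (c : Fin k → ℝ) :
    FGraph (Finset V) :=
  G.barycentric.induce (fun x =>
    k + 1 ≤ (vecSignValues F c x).card ∧
    ∀ j : Fin k, (fun i => if i = j then (-1 : ℝ) else 1) ∈ vecSignValues F c x)

end FGraph

/-- The complete graph on `Fin n`. -/
def completeFGraph (n : ℕ) : FGraph (Fin n) where
  verts := Finset.univ
  Adj a b := a ≠ b
  symm h := h.symm
  loopless a h := h rfl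
  mem_of_adj _ := Finset.mem_univ _

/-- Stirling numbers of the second kind. -/
def stirling2 : ℕ → ℕ → ℕ
  | 0, 0 => 1
  | 0, _ + 1 => 0
  | _ + 1, 0 => 0
  | n + 1, m + 1 => (m + 1) * stirling2 n (m + 1) + stirling2 n m

namespace FGraph

variable {V : Type}

/-- The vertex sets of complete subgraphs, including the empty set. -/
noncomputable def cliques (G : FGraph V) : Finset (Finset V) :=
  G.verts.powerset.filter (fun x => ∀ a ∈ x, ∀ b ∈ x, a ≠ b → G.Adj a b)

/-- The alternating count of cliques, including the empty one; equals `1 - χ(G)`. -/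
noncomputable def cliqueSum (G : FGraph V) : ℤ := ∑ z ∈ G.cliques, (-1 : ℤ) ^ z.card

theorem mem_cliques {G : FGraph V} {z : Finset V} :
    z ∈ G.cliques ↔ z ⊆ G.verts ∧ ∀ a ∈ z, ∀ b ∈ z, a ≠ b → G.Adj a b := by
  simp [cliques]

theorem empty_mem_cliques (G : FGraph V) : ∅ ∈ G.cliques := by
  simp [mem_cliques]

theorem mem_cliques_of_subset {G : FGraph V} {y z : Finset V} (h : y ⊆ z)
    (hz : z ∈ G.cliques) : y ∈ G.cliques := by
  rw [mem_cliques] at hz ⊢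
  exact ⟨h.trans hz.1, fun a ha b hb => hz.2 a (h ha) b (h hb)⟩

theorem mem_verts_induce {G : FGraph V} {P : V → Prop} {v : V} :
    v ∈ (G.induce P).verts ↔ v ∈ G.verts ∧ P v := by
  simp [induce]

theorem mem_verts_unitSphere {G : FGraph V} {v w : V} :
    w ∈ (G.unitSphere v).verts ↔ G.Adj v w := by
  rw [unitSphere, mem_verts_induce, and_iff_right_iff_imp]
  exact fun h => G.mem_of_adj (G.symm h)

theorem notMem_and_insert_mem_cliques {G : FGraph V} {v : V} (hv : v ∈ G.verts) {z : Finset V}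
    (hz : z ∈ (G.unitSphere v).cliques) : v ∉ z ∧ insert v z ∈ G.cliques := by
  rw [mem_cliques] at hz
  have hadj : ∀ a ∈ z, G.Adj v a := fun a ha => mem_verts_unitSphere.mp (hz.1 ha)
  refine ⟨fun h => G.loopless v (hadj v h), mem_cliques.mpr ⟨?_, ?_⟩⟩
  · intro a ha
    rcases Finset.mem_insert.mp ha with rfl | ha
    · exact hv
    · exact G.mem_of_adj (G.symm (hadj a ha))
  · intro a ha b hb hab
    rcases Finset.mem_insert.mp ha with ha' | ha' <;>
      rcases Finset.mem_insert.mp hb with hb' | hb'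
    · exact absurd (ha'.trans hb'.symm) hab
    · exact ha' ▸ hadj b hb'
    · exact hb' ▸ G.symm (hadj a ha')
    · exact (hz.2 a ha' b hb' hab).1

theorem erase_mem_cliques_unitSphere {G : FGraph V} {v : V} {z : Finset V}
    (hz : z ∈ G.cliques) (hv : v ∈ z) : z.erase v ∈ (G.unitSphere v).cliques := by
  rw [mem_cliques] at hz ⊢
  have hadj : ∀ a ∈ z.erase v, G.Adj v a := fun a ha =>
    hz.2 v hv a (Finset.mem_of_mem_erase ha) (Finset.ne_of_mem_erase ha).symm
  exact ⟨fun a ha => mem_verts_unitSphere.mpr (hadj a ha), fun a ha b hb hab =>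
    ⟨hz.2 a (Finset.mem_of_mem_erase ha) b (Finset.mem_of_mem_erase hb) hab, hadj a ha, hadj b hb⟩⟩

/-- Cliques containing `y ∋ v` correspond to cliques of the unit sphere of `v`
containing `y \ {v}`. -/
theorem sum_cliques_superset {G : FGraph V} {v : V} (hv : v ∈ G.verts) {y : Finset V}
    (hy : v ∈ y) :
    ∑ z ∈ G.cliques with y ⊆ z, (-1 : ℤ) ^ z.card =
      -∑ z ∈ (G.unitSphere v).cliques with y.erase v ⊆ z, (-1 : ℤ) ^ z.card := by
  rw [← Finset.sum_neg_distrib]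
  refine Finset.sum_bij' (fun z _ => z.erase v) (fun z _ => insert v z) ?_ ?_ ?_ ?_ ?_
  · intro z hz
    rw [Finset.mem_filter] at hz ⊢
    exact ⟨erase_mem_cliques_unitSphere hz.1 (hz.2 hy), Finset.erase_subset_erase v hz.2⟩
  · intro z hz
    rw [Finset.mem_filter] at hz ⊢
    exact ⟨(notMem_and_insert_mem_cliques hv hz.1).2,
      Finset.erase_subset_iff_of_mem (Finset.mem_insert_self v z) |>.mp
        (hz.2.trans (Finset.subset_insert v z))⟩
  · intro z hz
    exact Finset.insert_erase ((Finset.mem_filter.mp hz).2 hy)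
  · intro z hz
    exact Finset.erase_insert
      (notMem_and_insert_mem_cliques hv (Finset.mem_filter.mp hz).1).1
  · intro z hz
    rw [← Finset.card_erase_add_one ((Finset.mem_filter.mp hz).2 hy), pow_succ]
    ring

theorem cliques_erase (G : FGraph V) (v : V) :
    (G.erase v).cliques = G.cliques.filter (fun z => v ∉ z) := by
  ext z
  rw [Finset.mem_filter, mem_cliques, mem_cliques]
  constructor
  · rintro ⟨h1, h2⟩
    exact ⟨⟨fun a ha => (mem_verts_induce.mp (h1 ha)).1, fun a ha b hb hab => (h2 a ha b hb hab).1⟩,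
      fun hv => (mem_verts_induce.mp (h1 hv)).2 rfl⟩
  · rintro ⟨⟨h1, h2⟩, hv⟩
    have hne : ∀ a ∈ z, a ≠ v := fun a ha h => hv (h ▸ ha)
    exact ⟨fun a ha => mem_verts_induce.mpr ⟨h1 ha, hne a ha⟩,
      fun a ha b hb hab => ⟨h2 a ha b hb hab, hne a ha, hne b hb⟩⟩

theorem cliqueSum_eq_erase_sub_unitSphere {G : FGraph V} {v : V} (hv : v ∈ G.verts) :
    G.cliqueSum = (G.erase v).cliqueSum - (G.unitSphere v).cliqueSum := by
  have h := sum_cliques_superset hv (Finset.mem_singleton_self v)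
  simp only [Finset.singleton_subset_iff, Finset.erase_singleton, Finset.empty_subset,
    Finset.filter_true] at h
  rw [cliqueSum, cliqueSum, cliqueSum, cliques_erase,
    ← Finset.sum_filter_add_sum_filter_not G.cliques (fun z => v ∈ z), h]
  ring

theorem cliques_of_verts_eq_empty {G : FGraph V} (h : G.verts = ∅) : G.cliques = {∅} := by
  ext z
  simp only [mem_cliques, h, Finset.subset_empty, Finset.mem_singleton]
  constructor
  · exact fun h => h.1
  · rintro rfl
    simp

theorem Contractible.cliqueSum_eq_zero {G : FGraph V} (h : Contractible G) :
    G.cliqueSum = 0 := by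
  induction h with
  | single G v h =>
    have h1 : (G.erase v).verts = ∅ := by
      simp [erase, induce, h, Finset.filter_singleton]
    have h2 : (G.unitSphere v).verts = ∅ := by
      simp [unitSphere, induce, h, Finset.filter_singleton, G.loopless v]
    rw [cliqueSum_eq_erase_sub_unitSphere (v := v) (by simp [h]), cliqueSum, cliqueSum,
      cliques_of_verts_eq_empty h1, cliques_of_verts_eq_empty h2, sub_self]
  | step G v hv h1 h2 ih1 ih2 =>
    rw [cliqueSum_eq_erase_sub_unitSphere hv, ih1, ih2, sub_self]

theorem IsManifold.isSphere_unitSphere {d : ℤ} {G : FGraph V} (h : IsManifold d G) {v : V}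
    (hv : v ∈ G.verts) : 0 ≤ d ∧ IsSphere (d - 1) (G.unitSphere v) := by
  cases h with
  | intro _ hd _ h => exact ⟨hd, h v hv⟩

/-- The Euler relation for the stars of all simplices (including the empty one) of an
`(n-1)`-sphere. -/
theorem IsSphere.sum_cliques_superset (n : ℕ) {G : FGraph V} (h : IsSphere ((n : ℤ) - 1) G)
    {y : Finset V} (hy : y ∈ G.cliques) :
    ∑ z ∈ G.cliques with y ⊆ z, (-1 : ℤ) ^ z.card = (-1) ^ n := by
  induction n generalizing G y with
  | zero =>
    have hG : G.verts = ∅ := by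
      generalize hd : ((0 : ℕ) : ℤ) - 1 = d at h
      cases h with
      | empty _ h => exact h
      | punctured _ _ hm v hv _ =>
        have := (hm.isSphere_unitSphere hv).1
        simp at hd
        omega
    rw [cliques_of_verts_eq_empty hG] at hy ⊢
    rw [Finset.mem_singleton.mp hy]
    simp
  | succ n ih =>
    generalize hd : ((n + 1 : ℕ) : ℤ) - 1 = d at h
    cases h with
    | empty _ h => push_cast at hd; omega
    | punctured _ _ hm v hv hc =>
      have hd' : d - 1 = (n : ℤ) - 1 := by push_cast at hd; omega
      have hS : ∀ w ∈ G.verts, IsSphere ((n : ℤ) - 1) (G.unitSphere w) := fun w hw =>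
        hd' ▸ (hm.isSphere_unitSphere hw).2
      rcases y.eq_empty_or_nonempty with rfl | ⟨w, hw⟩
      · have := ih (hS v hv) (empty_mem_cliques _)
        simp only [Finset.empty_subset, Finset.filter_true] at this ⊢
        rw [← cliqueSum] at this ⊢
        rw [cliqueSum_eq_erase_sub_unitSphere hv, hc.cliqueSum_eq_zero, this, pow_succ]
        ring
      · have hwG := (mem_cliques.mp hy).1 hw
        rw [FGraph.sum_cliques_superset hwG hw,
          ih (hS w hwG) (erase_mem_cliques_unitSphere hy hw), pow_succ]
        ring

theorem IsManifold.sum_cliques_unitSphere_superset {d : ℤ} (hd : Odd d) {G : FGraph V}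
    (h : IsManifold d G) {v : V} (hv : v ∈ G.verts) :
    ∀ y ∈ (G.unitSphere v).cliques,
      ∑ z ∈ (G.unitSphere v).cliques with y ⊆ z, (-1 : ℤ) ^ z.card = -1 := by
  intro y hy
  obtain ⟨hd0, hS⟩ := h.isSphere_unitSphere hv
  lift d to ℕ using hd0
  rw [IsSphere.sum_cliques_superset d hS hy, Odd.neg_one_pow (by exact_mod_cast hd)]

theorem mem_verts_barycentric {G : FGraph V} {z : Finset V} :
    z ∈ G.barycentric.verts ↔ z.Nonempty ∧ z ∈ G.cliques := by
  refine Finset.mem_filter.trans ?_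
  rw [Finset.mem_powerset, mem_cliques, IsSimplex]
  exact ⟨fun h => ⟨h.2.1, h.1, h.2.2.2⟩, fun h => ⟨h.2.1, h.1, h.2.1, h.2.2⟩⟩

theorem numSimplices_eq_card_filter_cliques {G : FGraph V} {k : ℕ} (hk : k ≠ 0) :
    G.numSimplices k = (G.cliques.filter (fun z => z.card = k)).card := by
  refine congrArg Finset.card (Finset.ext fun z => ?_)
  rw [Finset.mem_filter, Finset.mem_filter, Finset.mem_powerset, mem_cliques]
  constructor
  · rintro ⟨h, ⟨_, _, h1⟩, h2⟩
    exact ⟨⟨h, h1⟩, h2⟩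
  · rintro ⟨⟨h, h1⟩, h2⟩
    exact ⟨h, ⟨Finset.card_ne_zero.mp (h2 ▸ hk), h, h1⟩, h2⟩

theorem sum_cliques_card {R : Type*} [CommRing R] (G : FGraph V) (g : ℕ → R) {n : ℕ}
    (hn : G.verts.card ≤ n) :
    ∑ z ∈ G.cliques, g z.card =
      g 0 + ∑ k ∈ Finset.range n, g (k + 1) * (G.numSimplices (k + 1) : R) := by
  have hmaps : ∀ z ∈ G.cliques, z.card ∈ Finset.range (n + 1) := fun z hz => by
    have := Finset.card_le_card (mem_cliques.mp hz).1
    rw [Finset.mem_range]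
    omega
  have hzero : G.cliques.filter (fun z => z.card = 0) = {∅} := by
    ext z
    simp only [Finset.mem_filter, Finset.card_eq_zero, Finset.mem_singleton]
    exact ⟨fun h => h.2, fun h => ⟨h ▸ empty_mem_cliques G, h⟩⟩
  rw [← Finset.sum_fiberwise_of_maps_to hmaps, Finset.sum_range_succ', hzero]
  rw [add_comm]
  congr 1
  · simp
  · refine Finset.sum_congr rfl fun k _ => ?_
    rw [numSimplices_eq_card_filter_cliques k.succ_ne_zero,
      Finset.sum_congr rfl (fun z hz => by rw [(Finset.mem_filter.mp hz).2]),
      Finset.sum_const, nsmul_eq_mul, mul_comm]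

theorem euler_eq_one_sub_cliqueSum (G : FGraph V) : G.euler = 1 - G.cliqueSum := by
  rw [cliqueSum, sum_cliques_card G (fun k => (-1 : ℤ) ^ k) le_rfl, euler, pow_zero,
    sub_add_cancel_left, ← Finset.sum_neg_distrib]
  refine Finset.sum_congr rfl fun k _ => ?_
  rw [pow_succ]
  simp

/-- If `φ` sums to `1` over every principal up-set of an inclusion poset, then it sums to
the Euler characteristic of the order complex. -/
theorem euler_eq_sum_of_sum_superset_eq_one (φ : Finset V → ℤ) (H : FGraph (Finset V))
    (hH : ∀ a ∈ H.verts, ∀ b ∈ H.verts, H.Adj a b ↔ a ⊂ b ∨ b ⊂ a)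
    (hφ : ∀ y ∈ H.verts, ∑ z ∈ H.verts with y ⊆ z, φ z = 1) :
    H.euler = ∑ z ∈ H.verts, φ z := by
  induction hn : H.verts.card using Nat.strong_induction_on generalizing H with
  | _ n ih =>
  rcases H.verts.eq_empty_or_nonempty with h0 | hne
  · rw [euler, h0]
    simp
  obtain ⟨m, hm⟩ := H.verts.exists_minimal hne
  have hmin : ∀ a ∈ H.verts, ¬ a ⊂ m := fun a ha h => hm.not_lt ha h
  have hmv := hm.1
  have hE : (H.erase m).verts = H.verts.erase m := by
    ext a; simp [erase, induce, and_comm]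
  have hS : (H.unitSphere m).verts = H.verts.filter (fun a => m ⊂ a) := by
    ext a
    simp only [unitSphere, induce, Finset.mem_filter, and_congr_right_iff]
    intro ha
    rw [hH m hmv a ha, or_iff_left (hmin a ha)]
  have key : ∀ P : Finset V → Prop, (∀ a b, a ∈ H.verts → b ∈ H.verts → P a → a ⊆ b → P b) →
      ¬ P m → (H.induce P).euler = ∑ z ∈ (H.induce P).verts, φ z := by
    intro P hP hPm
    refine ih _ ?_ (H.induce P) ?_ ?_ rfl
    · rw [← hn]
      exact Finset.card_lt_card (Finset.filter_ssubset.mpr ⟨m, hmv, hPm⟩)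
    · intro a ha b hb
      simp only [induce, Finset.mem_filter] at ha hb ⊢
      rw [hH a ha.1 b hb.1]
      tauto
    · intro y hy
      simp only [induce, Finset.mem_filter] at hy ⊢
      rw [← hφ y hy.1, Finset.filter_filter]
      congr 1
      refine Finset.filter_congr fun z hz => ?_
      exact ⟨fun h => h.2, fun h => ⟨hP y z hy.1 hz hy.2 h, h⟩⟩
  have kE : (H.erase m).euler = _ := key (fun w => w ≠ m)
    (fun a b ha hb h hab he => h (by
      subst he
      by_contra hne
      exact hmin a ha (hab.ssubset_of_ne hne))) (by simp)
  have kS : (H.unitSphere m).euler = _ := key (fun w => H.Adj m w)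
    (fun a b ha hb h hab => by
      rw [hH m hmv a ha, or_iff_left (hmin a ha)] at h
      exact (hH m hmv b hb).mpr (Or.inl (h.trans_subset hab))) (H.loopless m)
  change _ = ∑ z ∈ (H.erase m).verts, φ z at kE
  change _ = ∑ z ∈ (H.unitSphere m).verts, φ z at kS
  rw [hE] at kE
  rw [hS] at kS
  have h1 : H.euler = (H.erase m).euler + 1 - (H.unitSphere m).euler := by
    simp only [euler_eq_one_sub_cliqueSum]
    rw [cliqueSum_eq_erase_sub_unitSphere hmv]
    ring
  have h2 : (H.verts.filter (fun a => m ⊆ a)) = insert m (H.verts.filter (fun a => m ⊂ a)) := by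
    ext a
    simp only [Finset.mem_filter, Finset.mem_insert, subset_iff_ssubset_or_eq]
    constructor
    · rintro ⟨h, h' | h'⟩
      · exact Or.inr ⟨h, h'⟩
      · exact Or.inl h'.symm
    · rintro (rfl | ⟨h, h'⟩)
      · exact ⟨hmv, Or.inr rfl⟩
      · exact ⟨h, Or.inl h'⟩
  have h3 := hφ m hmv
  rw [h2, Finset.sum_insert (by simp)] at h3
  rw [h1, kE, kS, ← Finset.add_sum_erase _ _ hmv]
  linarith

theorem sum_cliques_mul_sum_subset {R : Type*} [CommRing R] {G : FGraph V} {c : ℤ}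
    (hG : ∀ y ∈ G.cliques, ∑ z ∈ G.cliques with y ⊆ z, (-1 : ℤ) ^ z.card = c)
    (g : Finset V → R) :
    ∑ z ∈ G.cliques, (-1 : R) ^ z.card * ∑ y ∈ z.powerset, g y =
      c * ∑ y ∈ G.cliques, g y := by
  simp only [Finset.mul_sum]
  rw [Finset.sum_comm' (t' := G.cliques) (s' := fun y => G.cliques.filter (fun z => y ⊆ z))]
  · refine Finset.sum_congr rfl fun y hy => ?_
    rw [← Finset.sum_mul, ← hG y hy]
    push_cast
    rfl
  · intro z y
    simp only [Finset.mem_powerset, Finset.mem_filter]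
    exact ⟨fun h => ⟨h, mem_cliques_of_subset h.2 h.1⟩, fun h => h.1⟩

theorem sum_powerset_neg_one_pow_div (z : Finset V) :
    ∑ y ∈ z.powerset, (-1 : ℝ) ^ y.card / (y.card + 1) = 1 / (z.card + 1) := by
  have hz : (z.card : ℝ) + 1 ≠ 0 := by positivity
  rw [Finset.sum_powerset_apply_card (fun k => (-1 : ℝ) ^ k / (k + 1)), eq_div_iff hz,
    Finset.sum_mul]
  have h := Int.alternating_sum_range_choose_of_ne (n := z.card + 1) (by omega)
  rw [Finset.sum_range_succ'] at h
  have h' := congrArg (Int.cast : ℤ → ℝ) h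
  push_cast at h'
  simp only [Nat.choose_zero_right, Nat.cast_one, mul_one] at h'
  rw [← sub_eq_zero, ← neg_eq_zero, ← h', neg_sub, sub_eq_add_neg, add_comm,
    ← Finset.sum_neg_distrib]
  congr 1
  refine Finset.sum_congr rfl fun k _ => ?_
  have hk : (k : ℝ) + 1 ≠ 0 := by positivity
  have hc : ((z.card : ℝ) + 1) * (z.card.choose k) = ((z.card + 1).choose (k + 1)) * (k + 1) := by
    exact_mod_cast Nat.add_one_mul_choose_eq z.card k
  rw [nsmul_eq_mul, pow_succ]
  field_simp
  linear_combination -hc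

/-- The curvature vanishes when the unit sphere satisfies the Euler relations of an even
dimensional sphere. -/
theorem sum_cliques_div_eq_zero {G : FGraph V}
    (hG : ∀ y ∈ G.cliques, ∑ z ∈ G.cliques with y ⊆ z, (-1 : ℤ) ^ z.card = -1) :
    ∑ z ∈ G.cliques, (-1 : ℝ) ^ z.card / (z.card + 1) = 0 := by
  have h := sum_cliques_mul_sum_subset hG (fun y => (-1 : ℝ) ^ y.card / (y.card + 1))
  simp only [sum_powerset_neg_one_pow_div, mul_one_div] at h
  push_cast at h
  linarith

/-- A form of Alexander duality: the subcomplexes on complementary vertex sets have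
opposite reduced Euler characteristics. -/
theorem sum_cliques_filter_add_eq_zero {G : FGraph V}
    (hG : ∀ y ∈ G.cliques, ∑ z ∈ G.cliques with y ⊆ z, (-1 : ℤ) ^ z.card = -1)
    (P : V → Prop) :
    ∑ z ∈ G.cliques with (∀ a ∈ z, P a), (-1 : ℤ) ^ z.card +
      ∑ z ∈ G.cliques with (∀ a ∈ z, ¬ P a), (-1 : ℤ) ^ z.card = 0 := by
  have h := sum_cliques_mul_sum_subset hG
    (fun y => if ∀ a ∈ y, ¬ P a then (-1 : ℤ) ^ y.card else 0)
  have hin : ∀ z : Finset V, (∑ y ∈ z.powerset, if ∀ a ∈ y, ¬ P a then (-1 : ℤ) ^ y.card else 0) =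
      if ∀ a ∈ z, P a then 1 else 0 := by
    intro z
    rw [← Finset.sum_filter]
    have : z.powerset.filter (fun y => ∀ a ∈ y, ¬ P a) =
        (z.filter (fun a => ¬ P a)).powerset := by
      ext y
      simp only [Finset.mem_filter, Finset.mem_powerset, Finset.subset_iff]
      exact ⟨fun h a ha => ⟨h.1 ha, h.2 a ha⟩, fun h => ⟨fun a ha => (h ha).1, fun a ha => (h ha).2⟩⟩
    rw [this, Finset.sum_powerset_neg_one_pow_card]
    simp [Finset.filter_eq_empty_iff]
  simp only [hin, mul_ite, mul_one, mul_zero] at h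
  rw [← Finset.sum_filter, ← Finset.sum_filter] at h
  push_cast at h
  linarith

theorem euler_levelSet_eq_zero {G : FGraph V}
    (hG : ∀ y ∈ G.cliques, ∑ z ∈ G.cliques with y ⊆ z, (-1 : ℤ) ^ z.card = -1)
    (f : V → ℝ) (c : ℝ) (hf : ∀ a ∈ G.verts, f a ≠ c) : (G.levelSet f c).euler = 0 := by
  have hverts : (G.levelSet f c).verts =
      G.cliques.filter (fun z => ¬ (∀ a ∈ z, f a < c) ∧ ¬ (∀ a ∈ z, ¬ f a < c)) := by
    ext z
    rw [levelSet, mem_verts_induce, mem_verts_barycentric, Finset.mem_filter]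
    simp only [sub_neg, sub_pos, not_forall, not_not, exists_prop]
    constructor
    · rintro ⟨⟨_, h⟩, ha, b, hb, hbc⟩
      exact ⟨h, ⟨b, hb, hbc.not_gt⟩, ha⟩
    · rintro ⟨h, ⟨b, hb, hbc⟩, ha⟩
      exact ⟨⟨⟨b, hb⟩, h⟩, ha, b, hb,
        lt_of_le_of_ne (not_lt.mp hbc) (hf b ((mem_cliques.mp h).1 hb)).symm⟩
  have hsimp : ∀ z ∈ (G.levelSet f c).verts, G.IsSimplex z := fun z hz =>
    (Finset.mem_filter.mp (mem_verts_induce.mp hz).1).2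
  rw [euler_eq_sum_of_sum_superset_eq_one (fun z => -(-1 : ℤ) ^ z.card)]
  · have h1 := hG ∅ (empty_mem_cliques G)
    simp only [Finset.empty_subset, Finset.filter_true] at h1
    have h2 := sum_cliques_filter_add_eq_zero hG (fun a => f a < c)
    have h3 : ∑ z ∈ G.cliques with ((∀ a ∈ z, f a < c) ∧ ∀ a ∈ z, ¬ f a < c),
        (-1 : ℤ) ^ z.card = 1 := by
      rw [Finset.sum_eq_single_of_mem ∅ (by simp [empty_mem_cliques])]
      · simp
      · intro z hz hne
        obtain ⟨a, ha⟩ := Finset.nonempty_iff_ne_empty.mpr hne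
        have h := (Finset.mem_filter.mp hz).2
        exact absurd (h.1 a ha) (h.2 a ha)
    rw [hverts, Finset.sum_neg_distrib, neg_eq_zero]
    simp only [Finset.sum_filter] at h2 h3 ⊢
    have h4 : ∀ z : Finset V,
        (if ¬ (∀ a ∈ z, f a < c) ∧ ¬ (∀ a ∈ z, ¬ f a < c) then (-1 : ℤ) ^ z.card else 0) =
        (-1) ^ z.card - (if ∀ a ∈ z, f a < c then (-1 : ℤ) ^ z.card else 0) -
        (if ∀ a ∈ z, ¬ f a < c then (-1 : ℤ) ^ z.card else 0) +
        (if (∀ a ∈ z, f a < c) ∧ ∀ a ∈ z, ¬ f a < c then (-1 : ℤ) ^ z.card else 0) := by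
      intro z
      split_ifs <;> first | (exfalso; tauto) | ring
    rw [Finset.sum_congr rfl fun z _ => h4 z, Finset.sum_add_distrib, Finset.sum_sub_distrib,
      Finset.sum_sub_distrib]
    linarith
  · intro a ha b hb
    have ha' := (mem_verts_induce.mp ha).2
    have hb' := (mem_verts_induce.mp hb).2
    exact ⟨fun h => h.1.2.2, fun h => ⟨⟨hsimp a ha, hsimp b hb, h⟩, ha', hb'⟩⟩
  · intro y hy
    rw [hverts, Finset.mem_filter] at hy
    rw [Finset.sum_neg_distrib, neg_eq_iff_eq_neg, hverts, Finset.filter_filter]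
    refine Eq.trans ?_ (hG y hy.1)
    refine Finset.sum_congr (Finset.filter_congr fun z _ => ⟨fun h => h.2, fun h =>
      ⟨⟨fun h' => ?_, fun h' => ?_⟩, h⟩⟩) fun _ _ => rfl
    · exact hy.2.1 fun a ha => h' a (h ha)
    · exact hy.2.2 fun a ha => h' a (h ha)

theorem curvature_eq_sum_cliques (G : FGraph V) (v : V) :
    G.curvature v = ∑ z ∈ (G.unitSphere v).cliques, (-1 : ℝ) ^ z.card / (z.card + 1) := by
  have hn : (G.unitSphere v).verts.card ≤ G.verts.card :=
    Finset.card_le_card (Finset.filter_subset _ _)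
  rw [sum_cliques_card _ (fun k => (-1 : ℝ) ^ k / (k + 1)) hn, curvature,
    Finset.sum_range_succ', add_comm]
  congr 1
  · simp
  · refine Finset.sum_congr rfl fun k _ => ?_
    rw [if_neg k.succ_ne_zero]
    ring

end FGraph

/-- For an odd-dimensional manifold, the curvature of a vertex `x` is
`K(x) = -E[χ(M_f(x))]/2`, where the expectation is taken over the uniformly random
bijections `f : V → {1,…,|V|}` and `M_f(x) = {f = f(x)}` is the central surface inside
the unit sphere `S(x)`. -/
theorem curvature_index_expectation_odd {V : Type} [Fintype V] [DecidableEq V]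
    (G : FGraph V) (hV : G.verts = Finset.univ) (d : ℤ) (hd : Odd d)
    (hG : FGraph.IsManifold d G) (x : V) :
    G.curvature x = -
      ((∑ e : V ≃ Fin (Fintype.card V),
          (((G.unitSphere x).levelSet (fun v => ((e v : ℕ) : ℝ) + 1)
              (((e x : ℕ) : ℝ) + 1)).euler : ℝ)) /
        (Nat.factorial (Fintype.card V))) / 2 := by
  have hE := hG.sum_cliques_unitSphere_superset hd (v := x) (by simp [hV])
  rw [FGraph.curvature_eq_sum_cliques, FGraph.sum_cliques_div_eq_zero hE,
    Finset.sum_eq_zero fun e _ => ?_]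
  · simp
  · rw [FGraph.euler_levelSet_eq_zero hE, Int.cast_zero]
    intro a ha h
    have hax : a = x := e.injective (Fin.ext (Nat.cast_injective (add_right_cancel h)))
    rw [hax, FGraph.mem_verts_unitSphere] at ha
    exact G.loopless x ha
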